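/- arXiv:2201.05247 — 3 statements merged into one kernel-verified Lean document; each statement's English description precedes it below -/
import Mathlib

section
/- Let d ∈ ℕ with 1 ≤ d, let ε ≥ 0, s₁ ≥ 0, s₂ ≥ 0. For i = 1, 2 let t_{i1} ≤ t_{i2} be real numbers, let p_{i1}, p_{i2} ∈ EuclideanSpace ℝ (Fin d), and let SEG_i : ℝ → EuclideanSpace ℝ (Fin d) be a function such that SEG_i t ∈ segment ℝ p_{i1} p_{i2} for every t ∈ Icc t_{i1} t_{i2}. Suppose that either (1) Icc t₁₁ t₁₂ ∩ Icc t₂₁ t₂₂ = ∅, or (2) ‖(p₁₁ + p₁₂)/2 - (p₂₁ + p₂₂)/2‖₁ ≥ ‖(p₁₁ - p₁₂)/2‖₁ + ‖(p₂₁ - p₂₂)/2‖₁ + (2ε + s₁ + s₂)·√d. Then for every t ∈ Icc t₁₁ t₁₂ ∩ Icc t₂₁ t₂₂, the Euclidean distance satisfies ‖SEG₁ t - SEG₂ t‖ ≥ (s₁ + ε) + (s₂ + ε). -/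
theorem EuclideanSpace.sum_abs_le_norm_mul_sqrt_card {ι : Type*} [Fintype ι]
    (x : EuclideanSpace ℝ ι) :
    ∑ i, |x i| ≤ ‖x‖ * Real.sqrt (Fintype.card ι) := by
  rw [EuclideanSpace.norm_eq, ← Real.sqrt_mul (by positivity)]
  apply Real.le_sqrt_of_sq_le
  have h := sq_sum_le_card_mul_sum_sq (s := Finset.univ) (f := fun i => |x i|)
  simp only [Real.norm_eq_abs]
  rwa [Finset.card_univ, mul_comm] at h

theorem EuclideanSpace.abs_midpoint_sub_apply_le_of_mem_segment {ι : Type*}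
    {p q x : EuclideanSpace ℝ ι} (hx : x ∈ segment ℝ p q) (i : ι) :
    |((2⁻¹ : ℝ) • (p + q)) i - x i| ≤ |((2⁻¹ : ℝ) • (p - q)) i| := by
  obtain ⟨a, b, ha, hb, hab, rfl⟩ := hx
  obtain rfl : b = 1 - a := by linarith
  simp only [PiLp.smul_apply, PiLp.add_apply, PiLp.sub_apply, smul_eq_mul]
  have h : 2⁻¹ * (p i + q i) - (a * p i + (1 - a) * q i)
      = (1 - 2 * a) * (2⁻¹ * (p i - q i)) := by ring
  rw [h, abs_mul]
  exact mul_le_of_le_one_left (abs_nonneg _) (abs_le.2 ⟨by linarith, by linarith⟩)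

theorem stmt_6 {d : ℕ} (hd : 1 ≤ d)
    (ε s₁ s₂ : ℝ) (hε : ε ≥ 0) (hs₁ : s₁ ≥ 0) (hs₂ : s₂ ≥ 0)
    (t₁₁ t₁₂ t₂₁ t₂₂ : ℝ) (ht₁ : t₁₁ ≤ t₁₂) (ht₂ : t₂₁ ≤ t₂₂)
    (p₁₁ p₁₂ p₂₁ p₂₂ : EuclideanSpace ℝ (Fin d))
    (SEG₁ SEG₂ : ℝ → EuclideanSpace ℝ (Fin d))
    (hSEG₁ : ∀ t ∈ Set.Icc t₁₁ t₁₂, SEG₁ t ∈ segment ℝ p₁₁ p₁₂)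
    (hSEG₂ : ∀ t ∈ Set.Icc t₂₁ t₂₂, SEG₂ t ∈ segment ℝ p₂₁ p₂₂)
    (hsafe : Set.Icc t₁₁ t₁₂ ∩ Set.Icc t₂₁ t₂₂ = ∅ ∨
      (∑ i, |((2⁻¹ : ℝ) • (p₁₁ + p₁₂) - (2⁻¹ : ℝ) • (p₂₁ + p₂₂)) i|) ≥
        (∑ i, |((2⁻¹ : ℝ) • (p₁₁ - p₁₂)) i|)
        + (∑ i, |((2⁻¹ : ℝ) • (p₂₁ - p₂₂)) i|)
        + (2 * ε + s₁ + s₂) * Real.sqrt d) :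
    ∀ t ∈ Set.Icc t₁₁ t₁₂ ∩ Set.Icc t₂₁ t₂₂,
      ‖SEG₁ t - SEG₂ t‖ ≥ (s₁ + ε) + (s₂ + ε) := by
  intro t ht
  obtain hdisj | hsep := hsafe
  · rw [hdisj] at ht
    exact ht.elim
  have hpt : ∀ i, |((2⁻¹ : ℝ) • (p₁₁ + p₁₂) - (2⁻¹ : ℝ) • (p₂₁ + p₂₂)) i| ≤
      |((2⁻¹ : ℝ) • (p₁₁ - p₁₂)) i| + |((2⁻¹ : ℝ) • (p₂₁ - p₂₂)) i|
        + |(SEG₁ t - SEG₂ t) i| := by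
    intro i
    have h₁ := abs_le.1 <|
      EuclideanSpace.abs_midpoint_sub_apply_le_of_mem_segment (hSEG₁ t ht.1) i
    have h₂ := abs_le.1 <|
      EuclideanSpace.abs_midpoint_sub_apply_le_of_mem_segment (hSEG₂ t ht.2) i
    have h₃ := abs_le.1 (le_refl |(SEG₁ t - SEG₂ t) i|)
    have hdiff := PiLp.sub_apply (x := SEG₁ t) (y := SEG₂ t) (i := i)
    rw [PiLp.sub_apply (x := (2⁻¹ : ℝ) • (p₁₁ + p₁₂))]
    exact abs_le.2 ⟨by linarith, by linarith⟩
  have hsum := Finset.sum_le_sum fun i (_ : i ∈ Finset.univ) => hpt i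
  rw [Finset.sum_add_distrib, Finset.sum_add_distrib] at hsum
  have hnorm := EuclideanSpace.sum_abs_le_norm_mul_sqrt_card (SEG₁ t - SEG₂ t)
  rw [Fintype.card_fin] at hnorm
  have hpos : 0 < Real.sqrt d := Real.sqrt_pos.2 (by exact_mod_cast hd)
  have hle : 2 * ε + s₁ + s₂ ≤ ‖SEG₁ t - SEG₂ t‖ :=
    le_of_mul_le_mul_right (by linarith) hpos
  linarith
end

section
/- Let K ∈ ℕ and let t : ℕ → ℝ satisfy t k ≤ t (k+1) for every k < K. Let a ≤ b be real numbers, let i < K, and let P : ℝ → Prop. Assume (cover) Icc (t i + a) (t (i+1) + b) ⊆ Icc (t 0) (t K), and assume that for every j < K, if Icc (t j) (t (j+1)) ∩ Icc (t i + a) (t (i+1) + b) ≠ ∅ then P s holds for every s ∈ Icc (t j) (t (j+1)). Then for every τ ∈ Icc (t i) (t (i+1)) and every τ' ∈ Icc (τ + a) (τ + b), P τ' holds. -/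
/-- A point between the first and the last term of a finite sequence lies between two consecutive
terms. -/
theorem exists_mem_Icc_succ_of_mem_Icc {α : Type*} [LinearOrder α] {t : ℕ → α} {K : ℕ}
    (hK : 0 < K) {x : α} (hx : x ∈ Set.Icc (t 0) (t K)) :
    ∃ j < K, x ∈ Set.Icc (t j) (t (j + 1)) := by
  induction K, hK using Nat.le_induction with
  | base => exact ⟨0, Nat.zero_lt_one, hx⟩
  | succ n _ ih =>
    rcases le_total x (t n) with h | h
    · obtain ⟨j, hj, hxj⟩ := ih ⟨hx.1, h⟩
      exact ⟨j, hj.trans n.lt_succ_self, hxj⟩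
    · exact ⟨n, n.lt_succ_self, h, hx.2⟩

theorem stmt_9 (K : ℕ) (t : ℕ → ℝ) (ht : ∀ k < K, t k ≤ t (k + 1))
    (a b : ℝ) (hab : a ≤ b) (i : ℕ) (hi : i < K) (P : ℝ → Prop)
    (hcover : Set.Icc (t i + a) (t (i + 1) + b) ⊆ Set.Icc (t 0) (t K))
    (henc : ∀ j < K,
      Set.Icc (t j) (t (j + 1)) ∩ Set.Icc (t i + a) (t (i + 1) + b) ≠ ∅ →
      ∀ s ∈ Set.Icc (t j) (t (j + 1)), P s) :
    ∀ τ ∈ Set.Icc (t i) (t (i + 1)), ∀ τ' ∈ Set.Icc (τ + a) (τ + b), P τ' := by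
  intro τ hτ τ' hτ'
  have hmem : τ' ∈ Set.Icc (t i + a) (t (i + 1) + b) :=
    Set.Icc_subset_Icc (by gcongr; exact hτ.1) (by gcongr; exact hτ.2) hτ'
  obtain ⟨j, hj, hτj⟩ := exists_mem_Icc_succ_of_mem_Icc (Nat.zero_lt_of_lt hi) (hcover hmem)
  exact henc j hj (Set.nonempty_iff_ne_empty.mp ⟨τ', hτj, hmem⟩) τ' hτj
end

section
/- Let K ∈ ℕ and let t : ℕ → ℝ satisfy t k ≤ t (k+1) for every k < K. Let 0 ≤ a ≤ b be real numbers, let i < K, and let P₁, P₂ : ℝ → Prop. Assume there exist j < K and τ' ∈ Icc (t j) (t (j+1)) ∩ Icc (t (i+1) + a) (t i + b) such that P₂ s holds for every s ∈ Icc (t j) (t (j+1)), and such that for every l ≤ j, if Icc (t l) (t (l+1)) ∩ Icc (t i) (t (i+1) + b) ≠ ∅ then P₁ s holds for every s ∈ Icc (t l) (t (l+1)). Then for every τ ∈ Icc (t i) (t (i+1)), there exists σ ∈ Icc (τ + a) (τ + b) such that P₂ σ holds and P₁ τ'' holds for every τ'' ∈ Icc τ σ. -/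
theorem le_of_forall_lt_le_succ {α : Type*} [Preorder α] {t : ℕ → α} {K : ℕ}
    (ht : ∀ k < K, t k ≤ t (k + 1)) {n : ℕ} (hn : n ≤ K) : t 0 ≤ t n := by
  induction n with
  | zero => exact le_rfl
  | succ n ih => exact (ih (Nat.le_of_succ_le hn)).trans (ht n hn)

theorem exists_mem_Icc_succ {α : Type*} [LinearOrder α] {t : ℕ → α} {x : α} {n : ℕ}
    (h0 : t 0 ≤ x) (hn : x ≤ t (n + 1)) : ∃ l ≤ n, x ∈ Set.Icc (t l) (t (l + 1)) := by
  induction n with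
  | zero => exact ⟨0, le_rfl, h0, hn⟩
  | succ n ih =>
    rcases le_total x (t (n + 1)) with h | h
    · obtain ⟨l, hl, hx⟩ := ih h
      exact ⟨l, hl.trans n.le_succ, hx⟩
    · exact ⟨n + 1, le_rfl, h, hn⟩

theorem stmt_11 (K : ℕ) (t : ℕ → ℝ) (ht : ∀ k < K, t k ≤ t (k + 1))
    (a b : ℝ) (ha : 0 ≤ a) (hab : a ≤ b) (i : ℕ) (hi : i < K)
    (P₁ P₂ : ℝ → Prop)
    (henc : ∃ j < K, ∃ τ' ∈ Set.Icc (t j) (t (j + 1)) ∩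
        Set.Icc (t (i + 1) + a) (t i + b),
      (∀ s ∈ Set.Icc (t j) (t (j + 1)), P₂ s) ∧
      (∀ l ≤ j,
        Set.Icc (t l) (t (l + 1)) ∩ Set.Icc (t i) (t (i + 1) + b) ≠ ∅ →
        ∀ s ∈ Set.Icc (t l) (t (l + 1)), P₁ s)) :
    ∀ τ ∈ Set.Icc (t i) (t (i + 1)), ∃ σ ∈ Set.Icc (τ + a) (τ + b),
      P₂ σ ∧ ∀ τ'' ∈ Set.Icc τ σ, P₁ τ'' := by
  obtain ⟨j, -, τ', ⟨⟨hjτ, hτj⟩, hτa, hτb⟩, h₂, h₁⟩ := henc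
  rintro τ ⟨hiτ, hτi⟩
  refine ⟨τ', ⟨by linarith, by linarith⟩, h₂ τ' ⟨hjτ, hτj⟩, ?_⟩
  rintro x ⟨hτx, hxτ⟩
  have h0 : t 0 ≤ x := (le_of_forall_lt_le_succ ht hi.le).trans (hiτ.trans hτx)
  obtain ⟨l, hl, hx⟩ := exists_mem_Icc_succ h0 (hxτ.trans hτj)
  have hi' := ht i hi
  exact h₁ l hl (Set.nonempty_iff_ne_empty.mp ⟨x, hx, by linarith, by linarith⟩) x hx
end
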